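/- Let α = [0; a₁, a₂, …] be a badly approximable real number with convergents (pₙ/qₙ)_{n ≥ 1}, and suppose that for some positive rational x and some finite word U of length r over the positive integers, the continued fraction expansion of α begins with the block U followed by U^x. Let α_U = [0; U, U, U, …] be the quadratic real number whose partial quotients are the periodic repetition of U. Then q_{r−1}·α_U² + (q_r − p_{r−1})·α_U − p_r = 0, and there is a constant c depending only on α (not on U, x, r) such that |q_{r−1}·α² + (q_r − p_{r−1})·α − p_r| ≤ c · q_r · q_{⌈(1+x)r⌉}^{-2}. -/

import Mathlib

open Filter Topology

/-- Distance from a real number to the nearest integer. -/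
noncomputable def nint (x : ℝ) : ℝ := |x - round x|

/-- A real number is badly approximable: `inf_{q ≥ 1} q·‖qα‖ > 0`. -/
def IsBad (α : ℝ) : Prop :=
  0 < ⨅ q : ℕ+, ((q : ℕ) : ℝ) * nint (((q : ℕ) : ℝ) * α)

/-- Denominators (continuants) of the continued fraction `[0; a 1, a 2, …]`:
`q 0 = 1`, `q 1 = a 1`, `q (j+2) = a (j+2) * q (j+1) + q j`. -/
def cfQ (a : ℕ → ℕ) : ℕ → ℕ
  | 0 => 1
  | 1 => a 1
  | n + 2 => a (n + 2) * cfQ a (n + 1) + cfQ a n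

/-- Numerators of the continued fraction `[0; a 1, a 2, …]`. -/
def cfP (a : ℕ → ℕ) : ℕ → ℕ
  | 0 => 0
  | 1 => 1
  | n + 2 => a (n + 2) * cfP a (n + 1) + cfP a n

/-- `a` (indexed from `1`) is the sequence of partial quotients of the continued
fraction expansion of `α`, i.e. `α = [0; a 1, a 2, …]`. -/
def IsCF (a : ℕ → ℕ) (α : ℝ) : Prop :=
  (∀ i, 1 ≤ i → 1 ≤ a i) ∧
    Tendsto (fun n => (cfP a n : ℝ) / (cfQ a n)) atTop (nhds α)

/-- For a positive rational `x`, `wordPow W x` is the word `W^x = W^{⌊x⌋} W'`,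
where `W'` is the prefix of `W` of length `⌈(x - ⌊x⌋)·|W|⌉`. -/
def wordPow (W : List ℕ) (x : ℚ) : List ℕ :=
  (List.replicate (⌊x⌋).toNat W).flatten ++
    W.take (⌈(x - (⌊x⌋ : ℚ)) * (W.length : ℚ)⌉).toNat

/-- `cfQ a n` only depends on the partial quotients `a 1, …, a n`. -/
theorem cfQ_congr {a b : ℕ → ℕ} : ∀ n, (∀ i, 1 ≤ i → i ≤ n → a i = b i) → cfQ a n = cfQ b n
  | 0, _ => rfl
  | 1, h => h 1 le_rfl le_rfl
  | n + 2, h => by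
    rw [cfQ, cfQ, h (n + 2) (by lia) le_rfl, cfQ_congr (n + 1) fun i h₁ h₂ => h i h₁ (by lia),
      cfQ_congr n fun i h₁ h₂ => h i h₁ (by lia)]

/-- `cfP a n` only depends on the partial quotients `a 1, …, a n`. -/
theorem cfP_congr {a b : ℕ → ℕ} : ∀ n, (∀ i, 1 ≤ i → i ≤ n → a i = b i) → cfP a n = cfP b n
  | 0, _ => rfl
  | 1, _ => rfl
  | n + 2, h => by
    rw [cfP, cfP, h (n + 2) (by lia) le_rfl, cfP_congr (n + 1) fun i h₁ h₂ => h i h₁ (by lia),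
      cfP_congr n fun i h₁ h₂ => h i h₁ (by lia)]

/-- Splitting a continuant after its first `k + 1` entries. -/
theorem cfQ_add (a : ℕ → ℕ) (k : ℕ) : ∀ m, cfQ a (k + 1 + m) =
    cfQ a (k + 1) * cfQ (fun i => a (k + 1 + i)) m + cfQ a k * cfP (fun i => a (k + 1 + i)) m
  | 0 => by simp [cfQ, cfP]
  | 1 => by simp [cfQ, cfP, mul_comm]
  | m + 2 => by
    have h : cfQ a (k + 1 + (m + 2)) =
      a (k + 1 + (m + 2)) * cfQ a (k + 1 + (m + 1)) + cfQ a (k + 1 + m) := rfl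
    rw [h, cfQ_add a k (m + 1), cfQ_add a k m]
    simp only [cfQ, cfP]
    ring

/-- Splitting the numerator of a continued fraction after its first `k + 1` entries. -/
theorem cfP_add (a : ℕ → ℕ) (k : ℕ) : ∀ m, cfP a (k + 1 + m) =
    cfP a (k + 1) * cfQ (fun i => a (k + 1 + i)) m + cfP a k * cfP (fun i => a (k + 1 + i)) m
  | 0 => by simp [cfQ, cfP]
  | 1 => by simp [cfQ, cfP, mul_comm]
  | m + 2 => by
    have h : cfP a (k + 1 + (m + 2)) =
      a (k + 1 + (m + 2)) * cfP a (k + 1 + (m + 1)) + cfP a (k + 1 + m) := rfl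
    rw [h, cfP_add a k (m + 1), cfP_add a k m]
    simp only [cfQ, cfP]
    ring

theorem cfQ_pos {a : ℕ → ℕ} (ha : ∀ i, 1 ≤ i → 1 ≤ a i) : ∀ n, 0 < cfQ a n
  | 0 => one_pos
  | 1 => ha 1 le_rfl
  | n + 2 => Nat.add_pos_right _ (cfQ_pos ha n)

theorem cfP_le_cfQ {a : ℕ → ℕ} (ha : ∀ i, 1 ≤ i → 1 ≤ a i) : ∀ n, cfP a n ≤ cfQ a n
  | 0 => Nat.zero_le _
  | 1 => ha 1 le_rfl
  | n + 2 => add_le_add (Nat.mul_le_mul_left _ (cfP_le_cfQ ha (n + 1))) (cfP_le_cfQ ha n)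

theorem cfQ_le_succ {a : ℕ → ℕ} (ha : ∀ i, 1 ≤ i → 1 ≤ a i) : ∀ n, cfQ a n ≤ cfQ a (n + 1)
  | 0 => ha 1 le_rfl
  | n + 1 => le_add_right (Nat.le_mul_of_pos_left _ (ha (n + 2) (by lia)))

/-- The determinant identity for consecutive convergents. -/
theorem cfP_mul_cfQ_sub (a : ℕ → ℕ) : ∀ n,
    (cfP a (n + 1) : ℝ) * cfQ a n - cfP a n * cfQ a (n + 1) = (-1) ^ n
  | 0 => by simp [cfP, cfQ]
  | n + 1 => by
    have h := cfP_mul_cfQ_sub a n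
    rw [cfP, cfQ]
    push_cast
    rw [pow_succ, ← h]
    ring

/-- Relation between the convergents of a continued fraction and those of a tail. -/
theorem convergent_add {a : ℕ → ℕ} (ha : ∀ i, 1 ≤ i → 1 ≤ a i) (k m : ℕ) :
    (cfP a (k + 1 + m) : ℝ) / cfQ a (k + 1 + m) * (cfQ a (k + 1) + cfQ a k *
      ((cfP (fun i => a (k + 1 + i)) m : ℝ) / cfQ (fun i => a (k + 1 + i)) m)) =
    cfP a (k + 1) + cfP a k *
      ((cfP (fun i => a (k + 1 + i)) m : ℝ) / cfQ (fun i => a (k + 1 + i)) m) := by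
  have h₁ : (0 : ℝ) < cfQ a (k + 1 + m) := by exact_mod_cast cfQ_pos ha _
  have h₂ : (0 : ℝ) < cfQ (fun i => a (k + 1 + i)) m := by
    exact_mod_cast cfQ_pos (fun i _ => ha (k + 1 + i) (by lia)) _
  have hQ : (cfQ a (k + 1 + m) : ℝ) = cfQ a (k + 1) * cfQ (fun i => a (k + 1 + i)) m +
      cfQ a k * cfP (fun i => a (k + 1 + i)) m := by exact_mod_cast cfQ_add a k m
  have hP : (cfP a (k + 1 + m) : ℝ) = cfP a (k + 1) * cfQ (fun i => a (k + 1 + i)) m +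
      cfP a k * cfP (fun i => a (k + 1 + i)) m := by exact_mod_cast cfP_add a k m
  field_simp
  rw [← hQ, hP]
  ring

theorem IsCF.mem_Icc {a : ℕ → ℕ} {α : ℝ} (h : IsCF a α) : α ∈ Set.Icc (0 : ℝ) 1 :=
  isClosed_Icc.mem_of_tendsto h.2 <| .of_forall fun n =>
    ⟨by positivity, div_le_one_of_le₀ (by exact_mod_cast cfP_le_cfQ h.1 n) (by positivity)⟩

/-- A continued fraction differs from its `n`-th convergent by at most `1 / (q n) ^ 2`. -/
theorem IsCF.abs_sub_convergent_le {a : ℕ → ℕ} {α : ℝ} (h : IsCF a α) (k : ℕ) :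
    |α - (cfP a (k + 1) : ℝ) / cfQ a (k + 1)| ≤ 1 / (cfQ a (k + 1) : ℝ) ^ 2 := by
  have ht : Tendsto (fun m => |(cfP a (k + 1 + m) : ℝ) / cfQ a (k + 1 + m) -
      (cfP a (k + 1) : ℝ) / cfQ a (k + 1)|) atTop
      (nhds |α - (cfP a (k + 1) : ℝ) / cfQ a (k + 1)|) := by
    have := h.2.comp (tendsto_add_atTop_nat (k + 1))
    simp only [Function.comp_def, add_comm _ (k + 1)] at this
    exact (this.sub_const _).abs
  refine le_of_tendsto' ht fun m => ?_
  have hc := convergent_add h.1 k m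
  have hd := cfP_mul_cfQ_sub a k
  have hq : (0 : ℝ) < cfQ a (k + 1) := by exact_mod_cast cfQ_pos h.1 _
  have hy₀ : (0 : ℝ) ≤ (cfP (fun i => a (k + 1 + i)) m : ℝ) / cfQ (fun i => a (k + 1 + i)) m := by
    positivity
  have hy₁ : (cfP (fun i => a (k + 1 + i)) m : ℝ) / cfQ (fun i => a (k + 1 + i)) m ≤ 1 :=
    div_le_one_of_le₀
      (by exact_mod_cast cfP_le_cfQ (fun i _ => h.1 (k + 1 + i) (by lia)) _) (by positivity)
  generalize (cfP (fun i => a (k + 1 + i)) m : ℝ) / cfQ (fun i => a (k + 1 + i)) m = y at *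
  generalize (cfP a (k + 1 + m) : ℝ) / cfQ a (k + 1 + m) = z at *
  have hz : 0 < (cfQ a (k + 1) : ℝ) + cfQ a k * y := by positivity
  have key : z - (cfP a (k + 1) : ℝ) / cfQ a (k + 1) =
      -((-1) ^ k * y) / (cfQ a (k + 1) * (cfQ a (k + 1) + cfQ a k * y)) := by
    rw [← hd, eq_div_of_mul_eq hz.ne' hc]
    field_simp
    ring
  rw [key, abs_div, abs_neg, abs_mul, abs_pow, abs_neg, abs_one, one_pow, one_mul,
    abs_of_nonneg hy₀, abs_of_pos (by positivity), sq]
  gcongr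
  exact le_add_of_nonneg_right (by positivity)

/-- Two continued fractions that share their first `n` partial quotients are close. -/
theorem IsCF.abs_sub_le {a b : ℕ → ℕ} {α β : ℝ} (ha : IsCF a α) (hb : IsCF b β) {n : ℕ}
    (hn : 1 ≤ n) (hab : ∀ i, 1 ≤ i → i ≤ n → a i = b i) :
    |α - β| ≤ 2 * (1 / (cfQ a n : ℝ) ^ 2) := by
  obtain ⟨k, rfl⟩ := Nat.exists_eq_add_of_le' hn
  have h₁ := ha.abs_sub_convergent_le k
  have h₂ := hb.abs_sub_convergent_le k
  rw [← cfQ_congr _ hab, ← cfP_congr _ hab, abs_sub_comm] at h₂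
  linarith [_root_.abs_sub_le α ((cfP a (k + 1) : ℝ) / cfQ a (k + 1)) β]

/-- The quadratic equation satisfied by a purely periodic continued fraction. -/
theorem IsCF.quadratic_of_periodic {a : ℕ → ℕ} {α : ℝ} (h : IsCF a α) (k : ℕ)
    (hper : ∀ i, 1 ≤ i → a (k + 1 + i) = a i) :
    (cfQ a k : ℝ) * α ^ 2 + ((cfQ a (k + 1) : ℝ) - cfP a k) * α - cfP a (k + 1) = 0 := by
  have ht := h.2.comp (tendsto_add_atTop_nat (k + 1))
  simp only [Function.comp_def, add_comm _ (k + 1)] at ht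
  have h₁ := ht.mul ((h.2.const_mul (cfQ a k : ℝ)).const_add (cfQ a (k + 1) : ℝ))
  have h₂ := (h.2.const_mul (cfP a k : ℝ)).const_add (cfP a (k + 1) : ℝ)
  have heq := tendsto_nhds_unique (h₁.congr fun m => by
    have := convergent_add h.1 k m
    rwa [cfQ_congr m fun i hi _ => hper i hi, cfP_congr m fun i hi _ => hper i hi] at this) h₂
  linarith

theorem getD_flatten_replicate_append_take (W : List ℕ) (m : ℕ) : ∀ k i : ℕ,
    i < ((List.replicate k W).flatten ++ W.take m).length →
    ((List.replicate k W).flatten ++ W.take m).getD i 0 = W.getD (i % W.length) 0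
  | 0, i, h => by
    simp only [List.replicate_zero, List.flatten_nil, List.nil_append, List.length_take,
      lt_min_iff] at h ⊢
    rw [Nat.mod_eq_of_lt h.2]
    simp [List.getD_eq_getElem?_getD, h.1]
  | k + 1, i, h => by
    rw [List.replicate_succ, List.flatten_cons, List.append_assoc] at h ⊢
    rcases lt_or_ge i W.length with hi | hi
    · rw [List.getD_append _ _ _ _ hi, Nat.mod_eq_of_lt hi]
    · rw [List.length_append] at h
      rw [List.getD_append_right _ _ _ _ hi,
        getD_flatten_replicate_append_take W m k _ (by lia), ← Nat.mod_eq_sub_mod hi]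

theorem getD_append_wordPow (W : List ℕ) (x : ℚ) (i : ℕ) (h : i < (W ++ wordPow W x).length) :
    (W ++ wordPow W x).getD i 0 = W.getD (i % W.length) 0 := by
  have heq : W ++ wordPow W x = (List.replicate (⌊x⌋.toNat + 1) W).flatten ++
      W.take (⌈(x - (⌊x⌋ : ℚ)) * (W.length : ℚ)⌉).toNat := by
    rw [wordPow, List.replicate_succ, List.flatten_cons, List.append_assoc]
  rw [heq] at h ⊢
  exact getD_flatten_replicate_append_take W _ _ i h

theorem length_append_wordPow (W : List ℕ) {x : ℚ} (hx : 0 < x) :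
    (W ++ wordPow W x).length = ⌈(1 + x) * (W.length : ℚ)⌉₊ := by
  have hf : 0 ≤ ⌊x⌋ := Int.floor_nonneg.2 hx.le
  have hfr : 0 ≤ x - (⌊x⌋ : ℚ) := Int.fract_nonneg x
  have hc : ⌈(x - (⌊x⌋ : ℚ)) * (W.length : ℚ)⌉ ≤ (W.length : ℤ) := by
    rw [Int.ceil_le]
    exact_mod_cast mul_le_of_le_one_left (by positivity) (Int.fract_lt_one x).le
  have hc₀ : 0 ≤ ⌈(x - (⌊x⌋ : ℚ)) * (W.length : ℚ)⌉ := Int.ceil_nonneg (by positivity)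
  have hsplit : (1 + x) * (W.length : ℚ) = (x - (⌊x⌋ : ℚ)) * (W.length : ℚ) +
      ((W.length + ⌊x⌋ * W.length : ℤ) : ℚ) := by
    push_cast
    ring
  have hlen : (W ++ wordPow W x).length = W.length + (⌊x⌋.toNat * W.length +
      (⌈(x - (⌊x⌋ : ℚ)) * (W.length : ℚ)⌉).toNat) := by
    simp only [wordPow, List.length_append, List.length_flatten, List.map_replicate,
      List.sum_replicate, smul_eq_mul, List.length_take]
    rw [min_eq_left (by lia)]
  rw [hlen, ← Int.ceil_toNat, hsplit, Int.ceil_add_intCast]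
  zify
  rw [Int.toNat_of_nonneg hf, Int.toNat_of_nonneg hc₀, Int.toNat_of_nonneg (by positivity)]
  ring

/-- key estimate in the proof of Theorem 4.  Let `α` be
badly approximable with expansion `a` and convergents `cfP a j / cfQ a j`.
There is a constant `c > 0`, depending only on `α`, such that: whenever the
expansion of `α` begins with a nonempty block `U` of length `r` followed by
`U^x` (for a positive rational `x`), the quadratic number
`α_U = [0; U, U, U, …]` satisfies
`q (r-1)·α_U² + (q r - p (r-1))·α_U - p r = 0` and
`|q (r-1)·α² + (q r - p (r-1))·α - p r| ≤ c · q r · (q ⌈(1+x)r⌉)⁻²`. -/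
theorem quadratic_approximation_of_repetition
    (α : ℝ) (a : ℕ → ℕ) (hcf : IsCF a α) (hbad : IsBad α) :
    ∃ c : ℝ, 0 < c ∧
      ∀ (x : ℚ), 0 < x → ∀ U : List ℕ, U ≠ [] →
        (∀ i < (U ++ wordPow U x).length,
          a (i + 1) = (U ++ wordPow U x).getD i 0) →
        ∀ αU : ℝ,
          Tendsto (fun n =>
              (cfP (fun i => U.getD ((i - 1) % U.length) 0) n : ℝ) /
                (cfQ (fun i => U.getD ((i - 1) % U.length) 0) n : ℝ))
            atTop (nhds αU) →
          (cfQ a (U.length - 1) : ℝ) * αU ^ 2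
              + ((cfQ a U.length : ℝ) - (cfP a (U.length - 1) : ℝ)) * αU
              - (cfP a U.length : ℝ) = 0 ∧
          |(cfQ a (U.length - 1) : ℝ) * α ^ 2
              + ((cfQ a U.length : ℝ) - (cfP a (U.length - 1) : ℝ)) * α
              - (cfP a U.length : ℝ)|
            ≤ c * (cfQ a U.length : ℝ) *
                (1 / (cfQ a ⌈(1 + x) * (U.length : ℚ)⌉₊ : ℝ) ^ 2) := by
  refine ⟨6, by norm_num, fun x hx U hU hUa αU hαU => ?_⟩
  obtain ⟨k, hk⟩ : ∃ k, U.length = k + 1 :=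
    Nat.exists_eq_add_one.2 (List.length_pos_iff.2 hU)
  have hlen := length_append_wordPow U hx
  set N := ⌈(1 + x) * (U.length : ℚ)⌉₊
  set b : ℕ → ℕ := fun i => U.getD ((i - 1) % U.length) 0 with hb
  have hrN : U.length ≤ N := by
    rw [← hlen, List.length_append]
    lia
  have hab : ∀ i, 1 ≤ i → i ≤ N → a i = b i := fun i h₁ h₂ => by
    obtain ⟨j, rfl⟩ := Nat.exists_eq_add_of_le' h₁
    rw [hUa j (by lia), getD_append_wordPow U x j (by lia)]
    simp only [hb, Nat.add_sub_cancel]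
  have hper : ∀ i, 1 ≤ i → b (k + 1 + i) = b i := fun i hi => by
    simp only [hb]
    rw [Nat.add_sub_assoc hi, ← hk, Nat.add_mod_left]
  have hbpos : ∀ i, 1 ≤ i → 1 ≤ b i := fun i _ => by
    have hlt : (i - 1) % U.length < U.length := Nat.mod_lt _ (by lia)
    have := hab ((i - 1) % U.length + 1) (by lia) (by lia)
    simp only [hb, Nat.add_sub_cancel, Nat.mod_mod] at this ⊢
    rw [← this]
    exact hcf.1 _ (by lia)
  have hbcf : IsCF b αU := ⟨hbpos, hαU⟩
  have hroot := hbcf.quadratic_of_periodic k hper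
  have hclose := hcf.abs_sub_le hbcf (by lia) hab
  have hle : ∀ n, n ≤ k + 1 → ∀ i, 1 ≤ i → i ≤ n → a i = b i :=
    fun n hn i h₁ h₂ => hab i h₁ (by lia)
  rw [← cfQ_congr k (hle k (by lia)), ← cfP_congr k (hle k (by lia)),
    ← cfQ_congr (k + 1) (hle _ le_rfl), ← cfP_congr (k + 1) (hle _ le_rfl)] at hroot
  rw [hk, Nat.add_sub_cancel]
  refine ⟨hroot, ?_⟩
  obtain ⟨hα₀, hα₁⟩ := hcf.mem_Icc
  obtain ⟨hβ₀, hβ₁⟩ := hbcf.mem_Icc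
  have hpq : (cfP a k : ℝ) ≤ cfQ a k := by exact_mod_cast cfP_le_cfQ hcf.1 k
  have hqq : (cfQ a k : ℝ) ≤ cfQ a (k + 1) := by exact_mod_cast cfQ_le_succ hcf.1 k
  have hp₀ : (0 : ℝ) ≤ cfP a k := by positivity
  have hq₀ : (0 : ℝ) ≤ cfQ a k := by positivity
  have hfactor : (cfQ a k : ℝ) * α ^ 2 + ((cfQ a (k + 1) : ℝ) - cfP a k) * α - cfP a (k + 1) =
      (α - αU) * (cfQ a k * (α + αU) + (cfQ a (k + 1) - cfP a k)) := by
    linear_combination hroot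
  have hbound : |(cfQ a k : ℝ) * (α + αU) + (cfQ a (k + 1) - cfP a k)| ≤
      3 * cfQ a (k + 1) := by
    rw [abs_of_nonneg (add_nonneg (by positivity) (by linarith))]
    nlinarith
  rw [hfactor, abs_mul]
  calc _ ≤ 2 * (1 / (cfQ a N : ℝ) ^ 2) * (3 * cfQ a (k + 1)) := by gcongr
    _ = _ := by ring
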